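/- Let C be a finite set of nonempty standard-form clauses. If C is satisfiable (some state satisfies every clause in C) but C is not an island, then there exists no linear order < on the variables such that C is <-primal non-conflicting. -/

import Mathlib

/-- A state assigns a Boolean value to every variable. -/
abbrev State (V : Type*) := V → Bool

/-- A state satisfies a clause (a finite set of literals) if at least one
of its literals is true in the state. -/
def Sat {V : Type*} (s : State V) (c : Finset (V × Bool)) : Prop :=
  ∃ l ∈ c, s l.1 = l.2

/-- A clause is in standard form if no variable occurs in it with both polarities. -/
def StdForm {V : Type*} (c : Finset (V × Bool)) : Prop :=
  ¬ ∃ x : V, (x, true) ∈ c ∧ (x, false) ∈ c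

/-- `l` is the primal literal of clause `c` with respect to the linear order `lo`:
it belongs to `c` and its variable is `lo`-least among the variables occurring in `c`. -/
def PrimalLit {V : Type*} (lo : LinearOrder V) (c : Finset (V × Bool)) (l : V × Bool) : Prop :=
  l ∈ c ∧ ∀ l' ∈ c, lo.le l.1 l'.1

/-- The primal literal set of a set of clauses with respect to the linear order `lo`. -/
def PLit {V : Type*} (lo : LinearOrder V) (C : Set (Finset (V × Bool))) : Set (V × Bool) :=
  {l | ∃ c ∈ C, PrimalLit lo c l}

/-- `C` is primal non-conflicting with respect to `lo` if no variable occurs with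
both polarities in the primal literal set of `C`. -/
def PrimalNonConflicting {V : Type*} (lo : LinearOrder V)
    (C : Set (Finset (V × Bool))) : Prop :=
  ¬ ∃ x : V, (x, true) ∈ PLit lo C ∧ (x, false) ∈ PLit lo C

/-- Two states are neighbours if they differ in the value of exactly one variable. -/
def Neighbour {V : Type*} (s s' : State V) : Prop :=
  ∃! x : V, s x ≠ s' x

/-- A set `C` of clauses is an island if any two states satisfying every clause of `C`
are connected by a finite sequence of states, each satisfying every clause of `C`,
in which consecutive states are neighbours. -/
def IsIsland {V : Type*} (C : Set (Finset (V × Bool))) : Prop :=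
  ∀ s₀ sN : State V, (∀ c ∈ C, Sat s₀ c) → (∀ c ∈ C, Sat sN c) →
    ∃ (n : ℕ) (p : Fin (n + 1) → State V),
      p 0 = s₀ ∧ p (Fin.last n) = sN ∧
      (∀ i, ∀ c ∈ C, Sat (p i) c) ∧
      ∀ i : Fin n, Neighbour (p i.castSucc) (p i.succ)

theorem Neighbour.symm {V : Type*} {s s' : State V} (h : Neighbour s s') : Neighbour s' s := by
  simpa only [Neighbour, ne_comm] using h

theorem neighbour_update {V : Type*} [DecidableEq V] (s : State V) (a : V) (b : Bool)
    (h : b ≠ s a) : Neighbour (Function.update s a b) s := by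
  refine ⟨a, by simpa using h, fun y hy => ?_⟩
  by_contra hya
  exact hy (by simp [hya])

/-- The neighbour relation restricted to the states satisfying every clause of `C`. -/
def SolutionStep {V : Type*} (C : Set (Finset (V × Bool))) (s s' : State V) : Prop :=
  (∀ c ∈ C, Sat s c) ∧ (∀ c ∈ C, Sat s' c) ∧ Neighbour s s'

theorem SolutionStep.symm {V : Type*} {C : Set (Finset (V × Bool))} {s s' : State V}
    (h : SolutionStep C s s') : SolutionStep C s' s :=
  ⟨h.2.1, h.1, h.2.2.symm⟩

theorem exists_chain_of_reflTransGen {α : Type*} {r : α → α → Prop} {a b : α}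
    (h : Relation.ReflTransGen r a b) :
    ∃ (n : ℕ) (p : ℕ → α), p 0 = a ∧ p n = b ∧ ∀ i < n, r (p i) (p (i + 1)) := by
  induction h using Relation.ReflTransGen.head_induction_on with
  | refl => exact ⟨0, fun _ => b, rfl, rfl, by simp⟩
  | @head x y hxy _ ih =>
    obtain ⟨n, p, h0, hn, hp⟩ := ih
    refine ⟨n + 1, fun i => Nat.casesOn i x p, rfl, hn, ?_⟩
    rintro (_ | i) hi
    · simpa [h0] using hxy
    · exact hp i (by omega)

theorem isIsland_of_reflTransGen {V : Type*} {C : Set (Finset (V × Bool))}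
    (h : ∀ s s' : State V, (∀ c ∈ C, Sat s c) → (∀ c ∈ C, Sat s' c) →
      Relation.ReflTransGen (SolutionStep C) s s') : IsIsland C := by
  intro s s' hs hs'
  obtain ⟨n, p, h0, hn, hp⟩ := exists_chain_of_reflTransGen (h s s' hs hs')
  refine ⟨n, fun i => p i, h0, by simpa using hn, fun i => ?_, fun i => (hp i i.2).2.2⟩
  rcases Nat.lt_succ_iff_lt_or_eq.mp i.2 with hi | hi
  · exact (hp i hi).1
  · simpa only [hi, hn] using hs'

theorem exists_primalLit {V : Type*} (lo : LinearOrder V) {c : Finset (V × Bool)}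
    (hc : c.Nonempty) : ∃ l, PrimalLit lo c l := by
  obtain ⟨l, hl, hmin⟩ := c.exists_min_image Prod.fst hc
  exact ⟨l, hl, hmin⟩

/-- Overwriting a solution on a lower set of variables by a state making all primal
literals true yields a solution. -/
theorem sat_of_eq_on_lower {V : Type*} [lo : LinearOrder V] {C : Set (Finset (V × Bool))}
    (hne : ∀ c ∈ C, c.Nonempty) {t s s' : State V} (ht : ∀ l ∈ PLit lo C, t l.1 = l.2)
    (hs : ∀ c ∈ C, Sat s c) {U : Finset V} (hU : IsLowerSet (U : Set V))
    (hin : ∀ x ∈ U, s' x = t x) (hout : ∀ x ∉ U, s' x = s x) : ∀ c ∈ C, Sat s' c := by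
  intro c hc
  obtain ⟨l, hl, hsl⟩ := hs c hc
  by_cases hlU : l.1 ∈ U
  · obtain ⟨p, hp⟩ := exists_primalLit lo (hne c hc)
    have hpU : p.1 ∈ U := hU (hp.2 l hl) hlU
    exact ⟨p, hp.1, (hin _ hpU).trans (ht p ⟨c, hc, hp⟩)⟩
  · exact ⟨l, hl, (hout _ hlU).trans hsl⟩

theorem reflTransGen_of_eq_on_lower {V : Type*} [lo : LinearOrder V]
    {C : Set (Finset (V × Bool))} (hne : ∀ c ∈ C, c.Nonempty) {t s : State V}
    (ht : ∀ l ∈ PLit lo C, t l.1 = l.2) (hs : ∀ c ∈ C, Sat s c) (U : Finset V)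
    (hU : IsLowerSet (U : Set V)) (s' : State V)
    (hin : ∀ x ∈ U, s' x = t x) (hout : ∀ x ∉ U, s' x = s x) :
    Relation.ReflTransGen (SolutionStep C) s s' := by
  induction U using Finset.induction_on_max generalizing s' with
  | empty =>
    obtain rfl : s' = s := funext fun x => hout x (by simp)
    exact .refl
  | insert a U hmax ih =>
    have haU : a ∉ U := fun h => lt_irrefl a (hmax a h)
    have hU' : IsLowerSet (U : Set V) := by
      intro x y hyx hx
      have hy : y ∈ insert a U := hU hyx (Finset.mem_insert_of_mem hx)
      exact (Finset.mem_insert.mp hy).resolve_left (hyx.trans_lt (hmax x hx)).ne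
    have hin' : ∀ x ∈ U, Function.update s' a (s a) x = t x := by
      intro x hx
      rw [Function.update_of_ne (hmax x hx).ne]
      exact hin x (Finset.mem_insert_of_mem hx)
    have hout' : ∀ x ∉ U, Function.update s' a (s a) x = s x := by
      intro x hx
      by_cases hxa : x = a
      · simp [hxa]
      · rw [Function.update_of_ne hxa]
        exact hout x (by simp [hxa, hx])
    have hreach := ih hU' _ hin' hout'
    by_cases h : s a = s' a
    · rwa [h, Function.update_eq_self] at hreach
    · exact hreach.tail ⟨sat_of_eq_on_lower hne ht hs hU' hin' hout',
        sat_of_eq_on_lower hne ht hs hU hin hout, neighbour_update s' a _ h⟩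

theorem PrimalNonConflicting.exists_state {V : Type*} {lo : LinearOrder V}
    {C : Set (Finset (V × Bool))} (h : PrimalNonConflicting lo C) :
    ∃ t : State V, ∀ l ∈ PLit lo C, t l.1 = l.2 := by
  classical
  refine ⟨fun x => decide ((x, true) ∈ PLit lo C), ?_⟩
  rintro ⟨x, _ | _⟩ hl
  · exact decide_eq_false fun hx => h ⟨x, hx, hl⟩
  · exact decide_eq_true hl

theorem PrimalNonConflicting.isIsland {V : Type*} [Finite V] {lo : LinearOrder V}
    {C : Set (Finset (V × Bool))} (h : PrimalNonConflicting lo C)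
    (hne : ∀ c ∈ C, c.Nonempty) : IsIsland C := by
  have := Fintype.ofFinite V
  obtain ⟨t, ht⟩ := h.exists_state
  have key : ∀ s : State V, (∀ c ∈ C, Sat s c) →
      Relation.ReflTransGen (SolutionStep C) s t := fun s hs =>
    reflTransGen_of_eq_on_lower hne ht hs Finset.univ (by simpa using isLowerSet_univ) t
      (fun _ _ => rfl) (fun x hx => absurd (Finset.mem_univ x) hx)
  have hsymm : Std.Symm (SolutionStep C) := ⟨fun _ _ => SolutionStep.symm⟩
  exact isIsland_of_reflTransGen fun s s' hs hs' =>
    (key s hs).trans (Std.Symm.symm _ _ (key s' hs'))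

/-- If a finite set of nonempty standard-form clauses is satisfiable but not an island,
then there is no linear order on the variables making it primal non-conflicting. -/
theorem not_island_no_primal_order {V : Type*} [DecidableEq V] [Fintype V]
    (C : Finset (Finset (V × Bool)))
    (hne : ∀ c ∈ C, Finset.Nonempty c) (hstd : ∀ c ∈ C, StdForm c)
    (hsat : ∃ s : State V, ∀ c ∈ C, Sat s c)
    (hni : ¬ IsIsland (↑C : Set (Finset (V × Bool)))) :
    ¬ ∃ lo : LinearOrder V, PrimalNonConflicting lo (↑C : Set (Finset (V × Bool))) := by
  rintro ⟨lo, hlo⟩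
  exact hni (hlo.isIsland hne)
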